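/- Fix q ∈ (0,1) and ν ∈ [0,1), and set α = ν(1−q)/(1−qν), β = (q−ν)/(1−qν), γ = (1−q)/(1−qν). Let 𝒜 be an associative (not necessarily commutative) ℝ-algebra with unit and let A, B ∈ 𝒜 satisfy B·A = α·A·A + β·A·B + γ·B·B. Then for every integer m ≥ 1, ((1−q)/(1−ν)) · ∑_{i=1}^{m} ( B^{i−1} A B^{m−i} − B^m ) = ∑_{j=1}^{m} φ̂(j|m) · ( A^j B^{m−j} − B^m ), where φ̂(j|m) = (ν^{j−1}/[j]_q)·((ν;q)_{m−j}/(ν;q)_m)·((q;q)_m/(q;q)_{m−j}). -/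

import Mathlib

/-- The finite `q`-Pochhammer symbol `(a;q)_n = ∏_{i=0}^{n−1}(1 − a q^i)`. -/
noncomputable def qPoch (a q : ℝ) (n : ℕ) : ℝ := ∏ i ∈ Finset.range n, (1 - a * q ^ i)

theorem qPoch_succ' (a q : ℝ) (n : ℕ) : qPoch a q (n+1) = qPoch a q n * (1 - a * q ^ n) := by
  simp [qPoch, Finset.prod_range_succ]

theorem one_sub_pos_aux {q a : ℝ} (hq : q ∈ Set.Ioo (0 : ℝ) 1) (ha : a ∈ Set.Ico (0 : ℝ) 1)
    (n : ℕ) : 0 < 1 - a * q ^ n := by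
  have h1 : q ^ n ≤ 1 := pow_le_one₀ hq.1.le hq.2.le
  have h2 : 0 ≤ q ^ n := pow_nonneg hq.1.le n
  nlinarith [ha.1, ha.2]

theorem qPoch_ne {q a : ℝ} (hq : q ∈ Set.Ioo (0 : ℝ) 1) (ha : a ∈ Set.Ico (0 : ℝ) 1)
    (n : ℕ) : qPoch a q n ≠ 0 :=
  Finset.prod_ne_zero_iff.2 fun i _ => ne_of_gt (one_sub_pos_aux hq ha i)

/-- Coefficient of `A^(k+1) B^(m-1-k)` in `∑ B^(i-1) A B^(m-i)`. -/
noncomputable def cF (q ν : ℝ) (m k : ℕ) : ℝ :=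
  (1 - ν) * ν ^ k / (1 - q ^ (k+1)) * (qPoch ν q (m - (k+1)) / qPoch ν q m) *
    (qPoch q q m / qPoch q q (m - (k+1)))

/-- Coefficient of `A^(k+1) B^(m-k)` in `B^m A`, for `k < m`. -/
noncomputable def cG (q ν : ℝ) (m k : ℕ) : ℝ :=
  (1 - ν) * (q - ν) * ν ^ k * q ^ (m - (k+1)) * (qPoch ν q (m - (k+1)) / qPoch ν q (m+1)) *
    (qPoch q q m / qPoch q q (m - k))

/-- Coefficient of `A^(m+1)` in `B^m A`. -/
noncomputable def cH (q ν : ℝ) (m : ℕ) : ℝ :=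
  (1 - ν) * ν ^ m * qPoch q q m / qPoch ν q (m+1)

/-- Coefficient of `B^(m+1)` in `B^m A`. -/
noncomputable def cE (q ν : ℝ) (m : ℕ) : ℝ := (1 - q ^ m) / (1 - ν * q ^ m)

section coeffs
variable {q ν : ℝ}

theorem one_sub_pow_ne (hq : q ∈ Set.Ioo (0 : ℝ) 1) (n : ℕ) : 1 - q ^ (n+1) ≠ 0 := by
  have := one_sub_pos_aux hq ⟨hq.1.le, hq.2⟩ n
  rw [pow_succ']; exact this.ne'

theorem cF_succ (hq : q ∈ Set.Ioo (0 : ℝ) 1) (hν : ν ∈ Set.Ico (0 : ℝ) 1)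
    {m k : ℕ} (h : k < m) : cF q ν (m+1) k = cF q ν m k + cG q ν m k := by
  obtain ⟨l, rfl⟩ : ∃ l, m = l + (k + 1) := ⟨m - (k+1), by omega⟩
  have hq' : q ∈ Set.Ico (0 : ℝ) 1 := ⟨hq.1.le, hq.2⟩
  have e1 : l + (k + 1) + 1 - (k + 1) = l + 1 := by omega
  have e2 : l + (k + 1) - (k + 1) = l := by omega
  have e3 : l + (k + 1) - k = l + 1 := by omega
  simp only [cF, cG, e1, e2, e3, qPoch_succ' _ _ l, qPoch_succ' _ _ (l + (k+1))]
  have h1 := qPoch_ne hq hν l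
  have h2 := qPoch_ne hq hν (l + (k+1))
  have h3 := qPoch_ne hq hq' l
  have h4 := qPoch_ne hq hq' (l + (k+1))
  have h5 := (one_sub_pos_aux hq hν l).ne'
  have h6 := (one_sub_pos_aux hq hν (l + (k+1))).ne'
  have h7 := (one_sub_pos_aux hq hq' l).ne'
  have h9 := one_sub_pow_ne hq k
  generalize qPoch ν q l = a at *
  generalize qPoch ν q (l+(k+1)) = b at *
  generalize qPoch q q l = c at *
  generalize qPoch q q (l+(k+1)) = d at *
  rw [pow_add q l (k+1)] at *
  generalize q ^ l = x at *
  generalize q ^ (k+1) = y at *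
  generalize hz : 1 - ν * (x * y) = z at *
  generalize hw : 1 - q * x = w at *
  generalize hu : 1 - ν * x = u at *
  generalize hv : 1 - y = v at *
  field_simp
  rw [← hz, ← hw, ← hu, ← hv]
  ring

theorem cF_last (hq : q ∈ Set.Ioo (0 : ℝ) 1) (m : ℕ) : cF q ν (m+1) m = cH q ν m := by
  have h9 := one_sub_pow_ne hq m
  simp only [cF, cH, Nat.sub_self]
  rw [qPoch_succ' q q m]
  have : q * q ^ m = q ^ (m+1) := by ring
  rw [this]
  simp only [qPoch, Finset.range_zero, Finset.prod_empty]
  field_simp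

theorem cE_eq (hq : q ∈ Set.Ioo (0 : ℝ) 1) (hν : ν ∈ Set.Ico (0 : ℝ) 1) (m : ℕ) :
    (1 - ν * q ^ m) * cE q ν m = 1 - q ^ m := by
  have h6 := (one_sub_pos_aux hq hν m).ne'
  simp only [cE]; field_simp

theorem cH_succ (hq : q ∈ Set.Ioo (0 : ℝ) 1) (hν : ν ∈ Set.Ico (0 : ℝ) 1) (m : ℕ) :
    (1 - ν * q ^ (m+1)) * cH q ν (m+1) = ν * (1 - q ^ (m+1)) * cH q ν m := by
  have h6 := (one_sub_pos_aux hq hν (m+1)).ne'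
  have h2 := qPoch_ne hq hν (m+1)
  simp only [cH, qPoch_succ' q q m, qPoch_succ' ν q (m+1)]
  field_simp
  ring

theorem cG_succ (hq : q ∈ Set.Ioo (0 : ℝ) 1) (hν : ν ∈ Set.Ico (0 : ℝ) 1) (m k : ℕ) :
    (1 - ν * q ^ (m+1)) * cG q ν (m+1) (k+1) = ν * (1 - q ^ (m+1)) * cG q ν m k := by
  have h6 := (one_sub_pos_aux hq hν (m+1)).ne'
  have h2 := qPoch_ne hq hν (m+1)
  have h3 := qPoch_ne hq ⟨hq.1.le, hq.2⟩ (m-k)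
  have e1 : m + 1 - (k + 1 + 1) = m - (k+1) := by omega
  have e2 : m + 1 - (k + 1) = m - k := by omega
  simp only [cG, e1, e2, qPoch_succ' q q m, qPoch_succ' ν q (m+1)]
  field_simp
  ring

theorem cG_zero (hq : q ∈ Set.Ioo (0 : ℝ) 1) (hν : ν ∈ Set.Ico (0 : ℝ) 1) (m : ℕ) :
    (1 - ν * q ^ (m+1)) * cG q ν (m+1) 0 = ν * (1 - q ^ (m+1)) * cE q ν m + (q ^ (m+1) - ν) := by
  have h5 := (one_sub_pos_aux hq hν m).ne'
  have h6 := (one_sub_pos_aux hq hν (m+1)).ne'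
  have h2 := qPoch_ne hq hν m
  have h3 := qPoch_ne hq ⟨hq.1.le, hq.2⟩ (m+1)
  simp only [cG, cE, zero_add, Nat.add_sub_cancel, Nat.sub_zero, qPoch_succ' ν q (m+1),
    qPoch_succ' ν q m]
  rw [pow_succ] at *
  generalize hz : 1 - ν * (q ^ m * q) = z at *
  generalize hu : 1 - ν * q ^ m = u at *
  field_simp
  rw [← hu]
  ring

end coeffs

section alg
variable {q ν : ℝ} {𝒜 : Type*} [Ring 𝒜] [Algebra ℝ 𝒜] {A B : 𝒜}

theorem three_term (hq : q ∈ Set.Ioo (0 : ℝ) 1) (hν : ν ∈ Set.Ico (0 : ℝ) 1)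
    (hrel : B * A = (ν * (1 - q) / (1 - q * ν)) • (A * A)
      + ((q - ν) / (1 - q * ν)) • (A * B) + ((1 - q) / (1 - q * ν)) • (B * B)) (m : ℕ) :
    (1 - ν * q ^ (m+1)) • (B ^ (m+1) * A) = (ν * (1 - q ^ (m+1))) • (A * (B ^ m * A))
      + (q ^ (m+1) - ν) • (A * B ^ (m+1)) + (1 - q ^ (m+1)) • B ^ (m+2) := by
  have hqν : 1 - q * ν ≠ 0 := by
    have := (one_sub_pos_aux hq hν 1).ne'
    rwa [pow_one, mul_comm] at this
  have hν1 : 1 - ν ≠ 0 := by linarith [hν.2]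
  have hrel' : (1 - q * ν) • (B * A) = (ν * (1 - q)) • (A * A)
      + (q - ν) • (A * B) + (1 - q) • (B * B) := by
    rw [hrel]
    simp only [smul_add, smul_smul]
    rw [mul_div_cancel₀ _ hqν, mul_div_cancel₀ _ hqν, mul_div_cancel₀ _ hqν]
  induction m with
  | zero =>
    simp only [zero_add, pow_one, pow_zero, one_mul, pow_two B]
    rw [mul_comm ν q]; exact hrel'
  | succ m ih =>
    have hB : ∀ W : 𝒜, (1 - q * ν) • (B * (A * W)) = (ν * (1 - q)) • (A * (A * W))
      + (q - ν) • (A * (B * W)) + (1 - q) • (B * (B * W)) := by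
      intro W
      have := congrArg (· * W) hrel'
      simpa only [add_mul, smul_mul_assoc, mul_assoc] using this
    have h1 := hB (B ^ m * A)
    have h2 := hB (B ^ (m+1))
    have h3 := congrArg (A * ·) ih
    have h4 := congrArg (B * ·) ih
    simp only [mul_add, mul_smul_comm] at h3 h4
    have p1 : B ^ (m+1+1) = B * (B * B ^ m) := by rw [pow_succ', pow_succ']
    have p2 : B ^ (m+2) = B * (B * B ^ m) := p1
    have p3 : B ^ (m+1) = B * B ^ m := pow_succ' _ _
    have p4 : B ^ (m+1+2) = B * (B * (B * B ^ m)) := by rw [pow_succ', pow_succ', pow_succ']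
    simp only [p1, p2, p3, p4, mul_assoc] at *
    rw [pow_succ q (m+1)]
    generalize q ^ (m+1) = x at *
    generalize A * (A * (B ^ m * A)) = w1 at *
    generalize A * (B * (B ^ m * A)) = w2 at *
    generalize B * (B * (B ^ m * A)) = w3 at *
    generalize B * (A * (B ^ m * A)) = w4 at *
    generalize B * (A * (B * B ^ m)) = w5 at *
    generalize A * (A * (B * B ^ m)) = w6 at *
    generalize A * (B * (B * B ^ m)) = w7 at *
    generalize B * (B * (B * B ^ m)) = w8 at *
    apply smul_right_injective 𝒜 hν1
    simp only
    linear_combination (norm := module) (1 - q * ν) • h4 + (ν * (1 - x)) • h1 + (x - ν) • h2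
      - (ν * (1-q)) • h3

theorem normal_form (hq : q ∈ Set.Ioo (0 : ℝ) 1) (hν : ν ∈ Set.Ico (0 : ℝ) 1)
    (hrel : B * A = (ν * (1 - q) / (1 - q * ν)) • (A * A)
      + ((q - ν) / (1 - q * ν)) • (A * B) + ((1 - q) / (1 - q * ν)) • (B * B)) (m : ℕ) :
    B ^ m * A = ∑ k ∈ Finset.range m, cG q ν m k • (A ^ (k+1) * B ^ (m - k))
      + cH q ν m • A ^ (m+1) + cE q ν m • B ^ (m+1) := by
  induction m with
  | zero =>
    have hν1 : 1 - ν ≠ 0 := by linarith [hν.2]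
    simp [cH, cE, qPoch, hν1]
  | succ m ih =>
    apply smul_right_injective 𝒜 (one_sub_pos_aux hq hν (m+1)).ne'
    simp only
    rw [three_term hq hν hrel, ih, Finset.sum_range_succ']
    simp only [smul_add, mul_add, Finset.mul_sum, Finset.smul_sum, mul_smul_comm, smul_smul,
      cG_succ hq hν, cG_zero hq hν, cH_succ hq hν, cE_eq hq hν, ← mul_assoc, ← pow_succ',
      Nat.add_sub_add_right, add_smul, zero_add, pow_one, Nat.sub_zero]
    abel

theorem sum_form (hq : q ∈ Set.Ioo (0 : ℝ) 1) (hν : ν ∈ Set.Ico (0 : ℝ) 1)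
    (hrel : B * A = (ν * (1 - q) / (1 - q * ν)) • (A * A)
      + ((q - ν) / (1 - q * ν)) • (A * B) + ((1 - q) / (1 - q * ν)) • (B * B)) (m : ℕ) :
    ∑ i ∈ Finset.range m, B ^ i * A * B ^ (m - (i+1)) =
      ∑ k ∈ Finset.range m, cF q ν m k • (A ^ (k+1) * B ^ (m - (k+1)))
      + (∑ k ∈ Finset.range m, cE q ν k) • B ^ m := by
  induction m with
  | zero => simp
  | succ m ih =>
    have hs : ∀ (f : ℕ → 𝒜), ∑ i ∈ Finset.range m, f i * B ^ (m + 1 - (i+1))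
        = (∑ i ∈ Finset.range m, f i * B ^ (m - (i+1))) * B := by
      intro f
      rw [Finset.sum_mul]
      refine Finset.sum_congr rfl fun i hi => ?_
      have := Finset.mem_range.1 hi
      rw [mul_assoc, ← pow_succ]
      congr 2; omega
    have e : ∑ k ∈ Finset.range m, cF q ν (m+1) k • (A ^ (k+1) * B ^ (m + 1 - (k+1)))
        = (∑ k ∈ Finset.range m, cF q ν m k • (A ^ (k+1) * B ^ (m - (k+1)))) * B
          + ∑ k ∈ Finset.range m, cG q ν m k • (A ^ (k+1) * B ^ (m - k)) := by
      simp only [← smul_mul_assoc]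
      rw [← hs, ← Finset.sum_add_distrib]
      refine Finset.sum_congr rfl fun k hk => ?_
      rw [cF_succ hq hν (Finset.mem_range.1 hk), add_smul, add_mul, Nat.add_sub_add_right]
    rw [Finset.sum_range_succ, hs, ih, Finset.sum_range_succ, e, Finset.sum_range_succ,
      cF_last hq, Nat.sub_self, pow_zero, mul_one, mul_one, normal_form hq hν hrel m, add_mul,
      add_smul, smul_mul_assoc, ← pow_succ]
    abel

end alg


/-- Degenerate non-commutative `q`-Hahn binomial identity.  Let `q ∈ (0,1)`,
`ν ∈ [0,1)`, `α = ν(1−q)/(1−qν)`, `β = (q−ν)/(1−qν)`, `γ = (1−q)/(1−qν)`.  If `A, B` in an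
associative unital `ℝ`-algebra satisfy `BA = αAA + βAB + γBB`, then for every `m ≥ 1`,
`((1−q)/(1−ν)) ∑_{i=1}^m (B^{i−1} A B^{m−i} − B^m) = ∑_{j=1}^m φ̂(j|m) (A^j B^{m−j} − B^m)`
with `φ̂(j|m) = (ν^{j−1}/[j]_q)·((ν;q)_{m−j}/(ν;q)_m)·((q;q)_m/(q;q)_{m−j})`. -/
theorem qHahn_noncommutative_binomial_degeneration (q ν : ℝ) (hq : q ∈ Set.Ioo (0 : ℝ) 1)
    (hν : ν ∈ Set.Ico (0 : ℝ) 1) (𝒜 : Type*) [Ring 𝒜] [Algebra ℝ 𝒜] (A B : 𝒜)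
    (hrel : B * A = (ν * (1 - q) / (1 - q * ν)) • (A * A)
      + ((q - ν) / (1 - q * ν)) • (A * B) + ((1 - q) / (1 - q * ν)) • (B * B)) :
    ∀ m : ℕ, 1 ≤ m →
      ((1 - q) / (1 - ν)) • ∑ i ∈ Finset.Icc 1 m, (B ^ (i - 1) * A * B ^ (m - i) - B ^ m)
        = ∑ j ∈ Finset.Icc 1 m,
            (ν ^ (j - 1) / ((1 - q ^ j) / (1 - q)) * (qPoch ν q (m - j) / qPoch ν q m) *
              (qPoch q q m / qPoch q q (m - j))) • (A ^ j * B ^ (m - j) - B ^ m) := by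
  intro m _
  have hν1 : 1 - ν ≠ 0 := by linarith [hν.2]
  have hq1 : 1 - q ≠ 0 := by linarith [hq.2]
  have hqν : 1 - q * ν ≠ 0 := by
    have := (one_sub_pos_aux hq hν 1).ne'
    rwa [pow_one, mul_comm] at this
  have hS := sum_form hq hν hrel m
  have h1 := sum_form (A := (1:ℝ)) (B := (1:ℝ)) hq hν (by
    simp only [smul_eq_mul, mul_one]
    rw [← add_div, ← add_div, eq_div_iff hqν]; ring) m
  simp only [one_pow, mul_one, smul_eq_mul, Finset.sum_const, Finset.card_range, nsmul_eq_mul]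
    at h1
  have hI : ∀ f : ℕ → 𝒜, ∑ i ∈ Finset.Icc 1 m, f i = ∑ i ∈ Finset.range m, f (i+1) := by
    intro f
    rw [Finset.range_eq_Ico, Finset.sum_Ico_add' f 0 m 1]
    rfl
  rw [hI, hI]
  have hc : ∀ k : ℕ, ν ^ (k + 1 - 1) / ((1 - q ^ (k+1)) / (1 - q)) *
      (qPoch ν q (m - (k+1)) / qPoch ν q m) * (qPoch q q m / qPoch q q (m - (k+1)))
      = ((1 - q) / (1 - ν)) * cF q ν m k := by
    intro k
    have h9 := one_sub_pow_ne hq k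
    simp only [cF, Nat.add_sub_cancel]
    field_simp
  simp only [hc, mul_smul, ← Finset.smul_sum]
  congr 1
  simp only [Nat.add_sub_cancel, smul_sub, Finset.sum_sub_distrib, ← Finset.sum_smul, hS]
  rw [Finset.sum_const, Finset.card_range, ← Nat.cast_smul_eq_nsmul ℝ, h1, add_smul]
  abel
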